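/- arXiv:math/0607506 — 7 statements merged into one kernel-verified Lean document; each statement's English description precedes it below -/
import Mathlib

section
/- For every real α, β and every ν > 0, the time-independent fields u_r = 0, u_θ(r,θ) = α/(r sin θ), u_φ = 0, p(r,θ) = β − α²/(2 r² sin²θ) satisfy, at every point with r > 0 and θ ∈ (0,π), the stationary three-dimensional Navier–Stokes equations in spherical coordinates: (i) u_r ∂_r u_r + (u_θ/r)∂_θ u_r + (u_φ/(r sin θ))∂_φ u_r − (u_θ² + u_φ²)/r = −∂_r p + ν(Δu_r + (2/r)∂_r u_r + 2u_r/r²); (ii) u_r ∂_r u_θ + (u_θ/r)∂_θ u_θ + (u_φ/(r sin θ))∂_φ u_θ + u_r u_θ/r − u_φ² cot θ/r = −(1/r)∂_θ p + ν(Δu_θ + (2/r²)∂_θ u_r − u_θ/(r² sin²θ) − (2cos θ/(r² sin²θ))∂_φ u_φ); (iii) u_r ∂_r u_φ + (u_θ/r)∂_θ u_φ + (u_φ/(r sin θ))∂_φ u_φ + u_r u_φ/r + u_θ u_φ cot θ/r = −(1/(r sin θ))∂_φ p + ν(Δu_φ + (2/(r² sin θ))∂_φ u_r + (2cos θ/(r²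 sin²θ))∂_φ u_θ − u_φ/(r² sin²θ)); (iv) (1/r²)∂_r(r² u_r) + (1/(r sin θ))∂_θ(sin θ · u_θ) + (1/(r sin θ))∂_φ u_φ = 0. -/
open Real

/-- The scalar Laplacian in spherical coordinates `(r, θ, φ)`:
`Δf = (1/r²)∂_r(r² ∂_r f) + (1/(r² sin θ))∂_θ(sin θ ∂_θ f) + (1/(r² sin²θ))∂²_φ f`. -/
noncomputable def sphericalLaplacian (f : ℝ → ℝ → ℝ → ℝ) (r θ φ : ℝ) : ℝ :=
  (1 / r ^ 2) * deriv (fun r' => r' ^ 2 * deriv (fun r'' => f r'' θ φ) r') r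
    + (1 / (r ^ 2 * Real.sin θ)) * deriv (fun t => Real.sin t * deriv (fun t' => f r t' φ) t) θ
    + (1 / (r ^ 2 * Real.sin θ ^ 2)) * deriv (fun p => deriv (fun p' => f r θ p') p) φ

/-- The radial derivative of `c / (r s)`. -/
theorem hasDerivAt_div_mul_const (c s : ℝ) {r : ℝ} (hr : r ≠ 0) :
    HasDerivAt (fun x => c / (x * s)) (-(c / (r ^ 2 * s))) r := by
  have h := (hasDerivAt_inv hr).const_mul (c / s)
  refine (h.congr_of_eventuallyEq (.of_forall fun x => ?_)).congr_deriv ?_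
  · simp only [div_eq_mul_inv, mul_inv]
    ring
  · simp only [div_eq_mul_inv, mul_inv]
    ring

/-- The polar derivative of `c / (r sin θ)`. -/
theorem hasDerivAt_div_mul_sin (c r : ℝ) {θ : ℝ} (hs : sin θ ≠ 0) :
    HasDerivAt (fun t => c / (r * sin t)) (-(c * cos θ / (r * sin θ ^ 2))) θ := by
  have h := ((hasDerivAt_sin θ).inv hs).const_mul (c / r)
  refine (h.congr_of_eventuallyEq (.of_forall fun x => ?_)).congr_deriv ?_
  · simp only [div_eq_mul_inv, mul_inv, Pi.inv_apply]
    ring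
  · simp only [div_eq_mul_inv, mul_inv]
    ring

/-- The pressure `b - a² / (2 r² sin² θ)` is `b - u² / 2` with `u = a / (r sin θ)`. -/
theorem sub_sq_div_eq_sub_half_sq (a b x y : ℝ) :
    b - a ^ 2 / (2 * x ^ 2 * y ^ 2) = b - (a / (x * y)) ^ 2 / 2 := by
  simp only [div_eq_mul_inv, mul_inv, mul_pow, inv_pow]
  ring

theorem eventually_sin_ne_zero {θ : ℝ} (hs : sin θ ≠ 0) : ∀ᶠ t in nhds θ, sin t ≠ 0 :=
  continuous_sin.continuousAt.eventually_ne hs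

/-- The spherical Laplacian of `a / (r sin θ)` is `a / (r³ sin³ θ)`. -/
theorem sphericalLaplacian_div_mul_sin (a : ℝ) {r θ : ℝ} (φ : ℝ) (hr : r ≠ 0)
    (hs : sin θ ≠ 0) :
    sphericalLaplacian (fun x t _ => a / (x * sin t)) r θ φ = a / (r ^ 3 * sin θ ^ 3) := by
  have hradial : deriv (fun x => x ^ 2 * deriv (fun y => a / (y * sin θ)) x) r = 0 := by
    have h : (fun x => x ^ 2 * deriv (fun y => a / (y * sin θ)) x) =ᶠ[nhds r]
        fun _ => -(a / sin θ) := by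
      filter_upwards [eventually_ne_nhds hr] with x hx
      rw [(hasDerivAt_div_mul_const a (sin θ) hx).deriv]
      field_simp
    rw [h.deriv_eq, deriv_const]
  have hpolar : deriv (fun t => sin t * deriv (fun y => a / (r * sin y)) t) θ =
      a / (r * sin θ ^ 2) := by
    have h : (fun t => sin t * deriv (fun y => a / (r * sin y)) t) =ᶠ[nhds θ]
        fun t => -(a / r) * (cos t / sin t) := by
      filter_upwards [eventually_sin_ne_zero hs] with t ht
      rw [(hasDerivAt_div_mul_sin a r ht).deriv]
      field_simp
    have hcot := ((hasDerivAt_cos θ).fun_div (hasDerivAt_sin θ) hs).const_mul (-(a / r))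
    rw [h.deriv_eq, hcot.deriv]
    field_simp
    linear_combination a * sin_sq_add_cos_sq θ
  simp only [sphericalLaplacian, hradial, hpolar, deriv_const]
  field_simp
  ring

/-- The stationary fields `u_r = 0`, `u_θ = α/(r sin θ)`, `u_φ = 0`,
`p = β − α²/(2 r² sin²θ)` satisfy the stationary three-dimensional Navier–Stokes
equations in spherical coordinates at every point with `r > 0`, `θ ∈ (0, π)`. -/
theorem stationary_solution_3D_NS_spherical (α β ν : ℝ) (hν : 0 < ν)
    (r θ φ : ℝ) (hr : 0 < r) (hθ : θ ∈ Set.Ioo 0 π) :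
    let ur : ℝ → ℝ → ℝ → ℝ := fun _ _ _ => 0
    let uθ : ℝ → ℝ → ℝ → ℝ := fun r' t _ => α / (r' * Real.sin t)
    let uφ : ℝ → ℝ → ℝ → ℝ := fun _ _ _ => 0
    let p : ℝ → ℝ → ℝ → ℝ := fun r' t _ => β - α ^ 2 / (2 * r' ^ 2 * Real.sin t ^ 2)
    -- (i) radial momentum equation
    (ur r θ φ * deriv (fun r' => ur r' θ φ) r
        + (uθ r θ φ / r) * deriv (fun t => ur r t φ) θ
        + (uφ r θ φ / (r * Real.sin θ)) * deriv (fun p' => ur r θ p') φ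
        - (uθ r θ φ ^ 2 + uφ r θ φ ^ 2) / r
      = - deriv (fun r' => p r' θ φ) r
        + ν * (sphericalLaplacian ur r θ φ + (2 / r) * deriv (fun r' => ur r' θ φ) r
            + 2 * ur r θ φ / r ^ 2))
    -- (ii) polar momentum equation
    ∧ (ur r θ φ * deriv (fun r' => uθ r' θ φ) r
        + (uθ r θ φ / r) * deriv (fun t => uθ r t φ) θ
        + (uφ r θ φ / (r * Real.sin θ)) * deriv (fun p' => uθ r θ p') φ
        + ur r θ φ * uθ r θ φ / r
        - uφ r θ φ ^ 2 * (Real.cos θ / Real.sin θ) / r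
      = - (1 / r) * deriv (fun t => p r t φ) θ
        + ν * (sphericalLaplacian uθ r θ φ + (2 / r ^ 2) * deriv (fun t => ur r t φ) θ
            - uθ r θ φ / (r ^ 2 * Real.sin θ ^ 2)
            - (2 * Real.cos θ / (r ^ 2 * Real.sin θ ^ 2)) * deriv (fun p' => uφ r θ p') φ))
    -- (iii) azimuthal momentum equation
    ∧ (ur r θ φ * deriv (fun r' => uφ r' θ φ) r
        + (uθ r θ φ / r) * deriv (fun t => uφ r t φ) θ
        + (uφ r θ φ / (r * Real.sin θ)) * deriv (fun p' => uφ r θ p') φ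
        + ur r θ φ * uφ r θ φ / r
        + uθ r θ φ * uφ r θ φ * (Real.cos θ / Real.sin θ) / r
      = - (1 / (r * Real.sin θ)) * deriv (fun p' => p r θ p') φ
        + ν * (sphericalLaplacian uφ r θ φ
            + (2 / (r ^ 2 * Real.sin θ)) * deriv (fun p' => ur r θ p') φ
            + (2 * Real.cos θ / (r ^ 2 * Real.sin θ ^ 2)) * deriv (fun p' => uθ r θ p') φ
            - uφ r θ φ / (r ^ 2 * Real.sin θ ^ 2)))
    -- (iv) incompressibility
    ∧ (1 / r ^ 2) * deriv (fun r' => r' ^ 2 * ur r' θ φ) r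
        + (1 / (r * Real.sin θ)) * deriv (fun t => Real.sin t * uθ r t φ) θ
        + (1 / (r * Real.sin θ)) * deriv (fun p' => uφ r θ p') φ = 0 := by
  have hr0 : r ≠ 0 := hr.ne'
  have hs : sin θ ≠ 0 := (sin_pos_of_mem_Ioo hθ).ne'
  have hpr : deriv (fun x => β - α ^ 2 / (2 * x ^ 2 * sin θ ^ 2)) r =
      α ^ 2 / (r ^ 3 * sin θ ^ 2) := by
    simp only [sub_sq_div_eq_sub_half_sq]
    rw [((((hasDerivAt_div_mul_const α (sin θ) hr0).fun_pow 2).div_const 2).const_sub β).deriv]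
    simp only [Nat.add_one_sub_one, pow_one, Nat.cast_ofNat]
    field_simp
  have hpθ : deriv (fun t => β - α ^ 2 / (2 * r ^ 2 * sin t ^ 2)) θ =
      α ^ 2 * cos θ / (r ^ 2 * sin θ ^ 3) := by
    simp only [sub_sq_div_eq_sub_half_sq]
    rw [((((hasDerivAt_div_mul_sin α r hs).fun_pow 2).div_const 2).const_sub β).deriv]
    simp only [Nat.add_one_sub_one, pow_one, Nat.cast_ofNat]
    field_simp
  have hdiv : deriv (fun t => sin t * (α / (r * sin t))) θ = 0 := by
    have h : (fun t => sin t * (α / (r * sin t))) =ᶠ[nhds θ] fun _ => α / r := by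
      filter_upwards [eventually_sin_ne_zero hs] with t ht
      field_simp
    rw [h.deriv_eq, deriv_const]
  have hzero : sphericalLaplacian (fun _ _ _ => 0) r θ φ = 0 := by
    simp [sphericalLaplacian]
  intro ur uθ uφ p
  simp only [ur, uθ, uφ, p, hpr, hpθ, hdiv, hzero, sphericalLaplacian_div_mul_sin α φ hr0 hs,
    (hasDerivAt_div_mul_sin α r hs).deriv, deriv_const, mul_zero]
  refine ⟨?_, ?_, ?_, ?_⟩
  · field_simp
    ring
  · field_simp
    ring
  · ring
  · ring
end

section
/- Let k be a nonzero integer, ν > 0, λ ∈ ℂ, and 0 < θ₀ < π/2. Suppose Ψ : (θ₀, π − θ₀) → ℂ is four times continuously differentiable and P : (θ₀, π − θ₀) → ℂ is twice continuously differentiable, and they satisfy, for all θ ∈ (θ₀, π − θ₀): P'(θ) = (1/sin θ)·(ν (Δ_k Ψ)(θ) − λ Ψ(θ)) and (k²/sin θ)·P(θ) = d/dθ[ν (Δ_k Ψ)(θ) − λ Ψ(θ)] − (1/sin θ)·(Δ_k Ψ)(θ). Then the function Φ := Δ_k Ψ satisfies ν (Δ_k Φ)(θ) − Φ'(θ)/sin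 θ = λ Φ(θ) and Φ(θ) = sin²θ · (Δ_k P)(θ) for all θ ∈ (θ₀, π − θ₀). -/
open Real

/-- The differential operator `(Δ_k f)(θ) = f''(θ) + (cos θ/sin θ) f'(θ) − (k²/sin²θ) f(θ)`. -/
noncomputable def DeltaK (k : ℤ) (f : ℝ → ℂ) (θ : ℝ) : ℂ :=
  deriv (deriv f) θ + (Real.cos θ / Real.sin θ : ℂ) * deriv f θ
    - ((k : ℂ) ^ 2 / (Real.sin θ : ℂ) ^ 2) * f θ

theorem contDiffOn_deltaK {k : ℤ} {f : ℝ → ℂ} {s : Set ℝ} (hs : IsOpen s)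
    (hsin : ∀ t ∈ s, (Real.sin t : ℂ) ≠ 0) (hf : ContDiffOn ℝ 4 f s) :
    ContDiffOn ℝ 2 (fun t => DeltaK k f t) s := by
  have hf' : ContDiffOn ℝ 3 (deriv f) s := hf.deriv_of_isOpen hs (by norm_num)
  have hf'' : ContDiffOn ℝ 2 (deriv (deriv f)) s := hf'.deriv_of_isOpen hs (by norm_num)
  have hS : ContDiffOn ℝ 2 (fun t : ℝ => (Real.sin t : ℂ)) s :=
    (Complex.ofRealCLM.contDiff.comp Real.contDiff_sin).contDiffOn
  have hC : ContDiffOn ℝ 2 (fun t : ℝ => (Real.cos t : ℂ)) s :=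
    (Complex.ofRealCLM.contDiff.comp Real.contDiff_cos).contDiffOn
  simp only [DeltaK, div_eq_mul_inv]
  exact (hf''.add ((hC.mul (hS.inv hsin)).mul (hf'.of_le (by norm_num)))).sub
    ((contDiffOn_const.mul ((hS.pow 2).inv fun t ht => pow_ne_zero 2 (hsin t ht))).mul
      (hf.of_le (by norm_num)))

theorem deltaK_const_mul_sub {k : ℤ} {f g : ℝ → ℂ} {s : Set ℝ} (hs : IsOpen s)
    (hf : ContDiffOn ℝ 2 f s) (hg : ContDiffOn ℝ 2 g s) (a b : ℂ) {θ : ℝ} (hθ : θ ∈ s) :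
    DeltaK k (fun t => a * f t - b * g t) θ = a * DeltaK k f θ - b * DeltaK k g θ := by
  have hd : ∀ t ∈ s, deriv (fun t => a * f t - b * g t) t = a * deriv f t - b * deriv g t := by
    intro t ht
    have hft := (hf.differentiableOn two_ne_zero).differentiableAt (hs.mem_nhds ht)
    have hgt := (hg.differentiableOn two_ne_zero).differentiableAt (hs.mem_nhds ht)
    exact ((hft.hasDerivAt.const_mul a).sub (hgt.hasDerivAt.const_mul b)).deriv
  have hf' : ContDiffOn ℝ 1 (deriv f) s := hf.deriv_of_isOpen hs (by norm_num)
  have hg' : ContDiffOn ℝ 1 (deriv g) s := hg.deriv_of_isOpen hs (by norm_num)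
  have hft := (hf'.differentiableOn one_ne_zero).differentiableAt (hs.mem_nhds hθ)
  have hgt := (hg'.differentiableOn one_ne_zero).differentiableAt (hs.mem_nhds hθ)
  have hdd : deriv (deriv fun t => a * f t - b * g t) θ
      = a * deriv (deriv f) θ - b * deriv (deriv g) θ := by
    rw [(Filter.eventuallyEq_of_mem (hs.mem_nhds hθ) hd).deriv_eq]
    exact ((hft.hasDerivAt.const_mul a).sub (hgt.hasDerivAt.const_mul b)).deriv
  simp only [DeltaK, hdd, hd θ hθ]
  ring

/-- If `(Ψ, P)` solve the coupled system for the stream function and the pressure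
with `k ≠ 0` on the truncated interval `(θ₀, π − θ₀)`, then `Φ := Δ_k Ψ` satisfies
the closed second-order equation `ν Δ_k Φ − Φ'/sin θ = λ Φ` together with
`Φ = sin²θ · Δ_k P`. -/
theorem vorticity_closed_equation (k : ℤ) (hk : k ≠ 0) (ν : ℝ) (hν : 0 < ν) (lam : ℂ)
    (θ₀ : ℝ) (hθ₀ : 0 < θ₀) (hθ₀' : θ₀ < π / 2)
    (Ψ P : ℝ → ℂ)
    (hΨ : ContDiffOn ℝ 4 Ψ (Set.Ioo θ₀ (π - θ₀)))
    (hP : ContDiffOn ℝ 2 P (Set.Ioo θ₀ (π - θ₀)))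
    (h1 : ∀ θ ∈ Set.Ioo θ₀ (π - θ₀),
      deriv P θ = (1 / (Real.sin θ : ℂ)) * ((ν : ℂ) * DeltaK k Ψ θ - lam * Ψ θ))
    (h2 : ∀ θ ∈ Set.Ioo θ₀ (π - θ₀),
      ((k : ℂ) ^ 2 / (Real.sin θ : ℂ)) * P θ
        = deriv (fun t => (ν : ℂ) * DeltaK k Ψ t - lam * Ψ t) θ
          - (1 / (Real.sin θ : ℂ)) * DeltaK k Ψ θ) :
    ∀ θ ∈ Set.Ioo θ₀ (π - θ₀),
      (ν : ℂ) * DeltaK k (fun t => DeltaK k Ψ t) θ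
          - deriv (fun t => DeltaK k Ψ t) θ / (Real.sin θ : ℂ)
        = lam * DeltaK k Ψ θ
      ∧ DeltaK k Ψ θ = (Real.sin θ : ℂ) ^ 2 * DeltaK k P θ := by
  have hs : IsOpen (Set.Ioo θ₀ (π - θ₀)) := isOpen_Ioo
  have hsin : ∀ t ∈ Set.Ioo θ₀ (π - θ₀), (Real.sin t : ℂ) ≠ 0 := fun t ht =>
    Complex.ofReal_ne_zero.mpr
      (Real.sin_pos_of_pos_of_lt_pi (hθ₀.trans ht.1) (by linarith [ht.2])).ne'
  have hΦ : ContDiffOn ℝ 2 (fun t => DeltaK k Ψ t) (Set.Ioo θ₀ (π - θ₀)) :=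
    contDiffOn_deltaK hs hsin hΨ
  have hΨ2 : ContDiffOn ℝ 2 Ψ (Set.Ioo θ₀ (π - θ₀)) := hΨ.of_le (by norm_num)
  intro θ hθ
  have hnhds := hs.mem_nhds hθ
  have hsθ := hsin θ hθ
  have hlin := deltaK_const_mul_sub (k := k) hs hΦ hΨ2 (ν : ℂ) lam hθ
  have hW2 : ContDiffOn ℝ 2 (fun t => (ν : ℂ) * DeltaK k Ψ t - lam * Ψ t)
      (Set.Ioo θ₀ (π - θ₀)) := (contDiffOn_const.mul hΦ).sub (contDiffOn_const.mul hΨ2)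
  have hWθ : (ν : ℂ) * DeltaK k Ψ θ - lam * Ψ θ
      = (fun t => (ν : ℂ) * DeltaK k Ψ t - lam * Ψ t) θ := rfl
  have h1θ := h1 θ hθ
  have h2θ := h2 θ hθ
  have hP' : deriv P =ᶠ[nhds θ] fun t => (1 / (Real.sin t : ℂ)) *
      (fun t => (ν : ℂ) * DeltaK k Ψ t - lam * Ψ t) t :=
    Filter.eventuallyEq_of_mem hnhds h1
  have hW' : deriv (fun t => (ν : ℂ) * DeltaK k Ψ t - lam * Ψ t) =ᶠ[nhds θ]
      fun t => (1 / (Real.sin t : ℂ)) * ((k : ℂ) ^ 2 * P t + DeltaK k Ψ t) :=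
    Filter.eventuallyEq_of_mem hnhds fun t ht => by linear_combination -h2 t ht
  rw [hWθ] at h1θ
  generalize (fun t => (ν : ℂ) * DeltaK k Ψ t - lam * Ψ t) = W at *
  have hPd := ((hP.differentiableOn two_ne_zero).differentiableAt hnhds).hasDerivAt
  have hΦd := ((hΦ.differentiableOn two_ne_zero).differentiableAt hnhds).hasDerivAt
  have hWd := ((hW2.differentiableOn two_ne_zero).differentiableAt hnhds).hasDerivAt
  have hinv : HasDerivAt (fun t : ℝ => 1 / (Real.sin t : ℂ))
      (-(Real.cos θ : ℂ) / (Real.sin θ : ℂ) ^ 2) θ := by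
    simpa only [one_div] using (Real.hasDerivAt_sin θ).ofReal_comp.fun_inv hsθ
  have hP'' := hP'.deriv_eq.trans (hinv.mul hWd).deriv
  have hW'' := hW'.deriv_eq.trans (hinv.mul ((hPd.const_mul ((k : ℂ) ^ 2)).add hΦd)).deriv
  have hW1 : (Real.sin θ : ℂ) * deriv W θ = (k : ℂ) ^ 2 * P θ + DeltaK k Ψ θ := by
    rw [hW'.self_of_nhds]
    field_simp
  constructor
  · have hΔW : DeltaK k W θ = deriv (fun t => DeltaK k Ψ t) θ / (Real.sin θ : ℂ) := by
      rw [DeltaK, hW'', h1θ]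
      simp only [Pi.add_apply]
      rw [← hW1]
      field_simp
      ring
    linear_combination hΔW - hlin
  · rw [DeltaK.eq_def k P, hP'', h1θ]
    field_simp
    linear_combination -hW1
end

section
/- Let ν > 0, λ ∈ ℂ, and 0 < θ₀ < π/2. Suppose Ψ : (θ₀, π − θ₀) → ℂ is four times continuously differentiable and satisfies d/dθ[ν (Δ₀ Ψ)(θ) − λ Ψ(θ)] − (1/sin θ)·(Δ₀ Ψ)(θ) = 0 for all θ ∈ (θ₀, π − θ₀). Then the function Φ := Δ₀ Ψ satisfies ν (Δ₀ Φ)(θ) − Φ'(θ)/sin θ = λ Φ(θ) for all θ ∈ (θ₀, π − θ₀). -/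
open Real

/-- The differential operator `(Δ₀ f)(θ) = f''(θ) + (cos θ/sin θ) f'(θ)`. -/
noncomputable def DeltaZero (f : ℝ → ℂ) (θ : ℝ) : ℂ :=
  deriv (deriv f) θ + (Real.cos θ / Real.sin θ : ℂ) * deriv f θ

/-- If `Ψ` solves the third-order equation
`d/dθ[ν Δ₀Ψ − λΨ] − (1/sin θ) Δ₀Ψ = 0` on `(θ₀, π − θ₀)`, then `Φ := Δ₀ Ψ`
satisfies the closed equation `ν Δ₀ Φ − Φ'/sin θ = λ Φ` there. -/
theorem vorticity_closed_equation_k0 (ν : ℝ) (hν : 0 < ν) (lam : ℂ)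
    (θ₀ : ℝ) (hθ₀ : 0 < θ₀) (hθ₀' : θ₀ < π / 2)
    (Ψ : ℝ → ℂ)
    (hΨ : ContDiffOn ℝ 4 Ψ (Set.Ioo θ₀ (π - θ₀)))
    (h : ∀ θ ∈ Set.Ioo θ₀ (π - θ₀),
      deriv (fun t => (ν : ℂ) * DeltaZero Ψ t - lam * Ψ t) θ
        - (1 / (Real.sin θ : ℂ)) * DeltaZero Ψ θ = 0) :
    ∀ θ ∈ Set.Ioo θ₀ (π - θ₀),
      (ν : ℂ) * DeltaZero (fun t => DeltaZero Ψ t) θ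
          - deriv (fun t => DeltaZero Ψ t) θ / (Real.sin θ : ℂ)
        = lam * DeltaZero Ψ θ := by
  have hopen : IsOpen (Set.Ioo θ₀ (π - θ₀)) := isOpen_Ioo
  have hΨ₁ : ContDiffOn ℝ 3 (deriv Ψ) (Set.Ioo θ₀ (π - θ₀)) :=
    hΨ.deriv_of_isOpen hopen (by norm_num)
  have hΨ₂ : ContDiffOn ℝ 2 (deriv (deriv Ψ)) (Set.Ioo θ₀ (π - θ₀)) :=
    hΨ₁.deriv_of_isOpen hopen (by norm_num)
  have hsin : ∀ t ∈ Set.Ioo θ₀ (π - θ₀), (Real.sin t : ℂ) ≠ 0 := fun t ht =>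
    Complex.ofReal_ne_zero.mpr
      (Real.sin_pos_of_pos_of_lt_pi (hθ₀.trans ht.1) (by linarith [ht.2])).ne'
  have hd : ∀ t ∈ Set.Ioo θ₀ (π - θ₀), DifferentiableAt ℝ Ψ t := fun t ht =>
    (hΨ.differentiableOn (by norm_num)).differentiableAt (hopen.mem_nhds ht)
  have hd₁ : ∀ t ∈ Set.Ioo θ₀ (π - θ₀), DifferentiableAt ℝ (deriv Ψ) t := fun t ht =>
    (hΨ₁.differentiableOn (by norm_num)).differentiableAt (hopen.mem_nhds ht)
  have hd₂ : ∀ t ∈ Set.Ioo θ₀ (π - θ₀), DifferentiableAt ℝ (deriv (deriv Ψ)) t := fun t ht =>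
    (hΨ₂.differentiableOn (by norm_num)).differentiableAt (hopen.mem_nhds ht)
  have hs : ∀ t, HasDerivAt (fun t : ℝ => (Real.sin t : ℂ)) (Real.cos t : ℂ) t :=
    fun t => (Real.hasDerivAt_sin t).ofReal_comp
  have hc : ∀ t, HasDerivAt (fun t : ℝ => (Real.cos t : ℂ)) ((-Real.sin t : ℝ) : ℂ) t :=
    fun t => (Real.hasDerivAt_cos t).ofReal_comp
  have hΦ : ∀ t ∈ Set.Ioo θ₀ (π - θ₀), DifferentiableAt ℝ (DeltaZero Ψ) t := fun t ht =>
    (hd₂ t ht).add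
      (((hc t).differentiableAt.div (hs t).differentiableAt (hsin t ht)).mul (hd₁ t ht))
  have first_order : ∀ t ∈ Set.Ioo θ₀ (π - θ₀),
      (ν : ℂ) * deriv (DeltaZero Ψ) t
        = lam * deriv Ψ t + DeltaZero Ψ t / (Real.sin t : ℂ) := by
    intro t ht
    have hderiv := (((hΦ t ht).hasDerivAt.const_mul (ν : ℂ)).sub
      ((hd t ht).hasDerivAt.const_mul lam)).deriv
    have ht' := h t ht
    erw [hderiv] at ht'
    linear_combination ht'
  intro θ hθ
  have second_order : (ν : ℂ) * deriv (deriv (DeltaZero Ψ)) θ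
      = lam * deriv (deriv Ψ) θ
        + (deriv (DeltaZero Ψ) θ * (Real.sin θ : ℂ) - DeltaZero Ψ θ * (Real.cos θ : ℂ))
          / (Real.sin θ : ℂ) ^ 2 := by
    have heq : (fun t => (ν : ℂ) * deriv (DeltaZero Ψ) t) =ᶠ[nhds θ]
        fun t => lam * deriv Ψ t + DeltaZero Ψ t / (Real.sin t : ℂ) :=
      Filter.eventually_of_mem (hopen.mem_nhds hθ) first_order
    rw [← deriv_const_mul_field, heq.deriv_eq]
    exact (((hd₁ θ hθ).hasDerivAt.const_mul lam).add
      ((hΦ θ hθ).hasDerivAt.div (hs θ) (hsin θ hθ))).deriv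
  have hfirst := first_order θ hθ
  have hne := hsin θ hθ
  have hdef : DeltaZero Ψ θ
      = deriv (deriv Ψ) θ + (Real.cos θ / Real.sin θ : ℂ) * deriv Ψ θ := rfl
  change (ν : ℂ) * (deriv (deriv (DeltaZero Ψ)) θ
      + (Real.cos θ / Real.sin θ : ℂ) * deriv (DeltaZero Ψ) θ)
    - deriv (DeltaZero Ψ) θ / (Real.sin θ : ℂ) = lam * DeltaZero Ψ θ
  have hcancel : (deriv (DeltaZero Ψ) θ * (Real.sin θ : ℂ) - DeltaZero Ψ θ * (Real.cos θ : ℂ))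
      / (Real.sin θ : ℂ) ^ 2 = deriv (DeltaZero Ψ) θ / (Real.sin θ : ℂ)
        - (Real.cos θ / Real.sin θ : ℂ) * (DeltaZero Ψ θ / (Real.sin θ : ℂ)) := by
    field_simp
  linear_combination second_order + hcancel
    + (Real.cos θ / Real.sin θ : ℂ) * hfirst - lam * hdef
end

section
/- Let k be an integer, ε ≥ 0, σ = √(k² + ε²/4), and μ ∈ ℂ. Suppose φ : (−1,1) → ℂ is twice continuously differentiable and satisfies the associated Legendre equation ((1 − x²) φ'(x))' − (σ²/(1 − x²)) φ(x) = μ φ(x) for all x ∈ (−1,1). Then the function Φ(x) := ((1 − x)/(1 + x))^{ε/4} · φ(x) satisfies (L_k Φ)(x) + ε Φ'(x) = μ Φ(x) for all x ∈ (−1,1). -/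
/-- Logarithmic derivative of the weight `((1 − x)/(1 + x))^a`. -/
theorem hasDerivAt_div_rpow (a : ℝ) {x : ℝ} (hx : x ∈ Set.Ioo (-1 : ℝ) 1) :
    HasDerivAt (fun y : ℝ => ((1 - y) / (1 + y)) ^ a)
      (-(2 * a / (1 - x ^ 2)) * ((1 - x) / (1 + x)) ^ a) x := by
  obtain ⟨h₁, h₂⟩ := hx
  have hm : 0 < 1 - x := by linarith
  have hp : 0 < 1 + x := by linarith
  have hq : 1 - x ^ 2 = (1 - x) * (1 + x) := by ring
  have hb : 0 < (1 - x) / (1 + x) := div_pos hm hp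
  have hd : HasDerivAt (fun y : ℝ => (1 - y) / (1 + y))
      ((-1 * (1 + x) - (1 - x) * 1) / (1 + x) ^ 2) x :=
    ((hasDerivAt_id x).const_sub 1).div ((hasDerivAt_id x).const_add 1) hp.ne'
  convert hd.rpow_const (p := a) (Or.inl hb.ne') using 1
  rw [Real.rpow_sub_one hb.ne', hq]
  field_simp
  ring


open Real

/-- The Sturm–Liouville operator `(L_k g)(x) = ((1 − x²) g'(x))' − (k²/(1 − x²)) g(x)`. -/
noncomputable def SturmLiouvilleK (k : ℤ) (g : ℝ → ℂ) (x : ℝ) : ℂ :=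
  deriv (fun y => ((1 - y ^ 2 : ℝ) : ℂ) * deriv g y) x
    - ((k : ℂ) ^ 2 / ((1 - x ^ 2 : ℝ) : ℂ)) * g x

/-- If `φ` solves the associated Legendre equation with parameter
`σ = √(k² + ε²/4)` and spectral parameter `μ` on `(−1,1)`, then
`Φ(x) = ((1 − x)/(1 + x))^{ε/4} φ(x)` solves `L_k Φ + ε Φ' = μ Φ` there. -/
theorem Legendre_to_linearized (k : ℤ) (ε : ℝ) (hε : 0 ≤ ε)
    (σ : ℝ) (hσ : σ = Real.sqrt ((k : ℝ) ^ 2 + ε ^ 2 / 4))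
    (μ : ℂ) (φ : ℝ → ℂ)
    (hφ : ContDiffOn ℝ 2 φ (Set.Ioo (-1 : ℝ) 1))
    (heq : ∀ x ∈ Set.Ioo (-1 : ℝ) 1,
      deriv (fun y => ((1 - y ^ 2 : ℝ) : ℂ) * deriv φ y) x
        - ((σ ^ 2 / (1 - x ^ 2) : ℝ) : ℂ) * φ x = μ * φ x) :
    ∀ x ∈ Set.Ioo (-1 : ℝ) 1,
      SturmLiouvilleK k (fun y => (((((1 - y) / (1 + y)) ^ (ε / 4) : ℝ)) : ℂ) * φ y) x
          + (ε : ℂ) * deriv (fun y => (((((1 - y) / (1 + y)) ^ (ε / 4) : ℝ)) : ℂ) * φ y) x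
        = μ * ((((((1 - x) / (1 + x)) ^ (ε / 4) : ℝ)) : ℂ) * φ x) := by
  intro x hx
  have hσ2 : σ ^ 2 = (k : ℝ) ^ 2 + ε ^ 2 / 4 := by
    rw [hσ, Real.sq_sqrt (by positivity)]
  have hpos : ∀ y ∈ Set.Ioo (-1 : ℝ) 1, ((1 - y ^ 2 : ℝ) : ℂ) ≠ 0 := fun y hy =>
    Complex.ofReal_ne_zero.2 (by nlinarith [hy.1, hy.2])
  set w : ℝ → ℂ := fun y => ((((1 - y) / (1 + y)) ^ (ε / 4) : ℝ) : ℂ) with hw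
  have hwd : ∀ y ∈ Set.Ioo (-1 : ℝ) 1,
      HasDerivAt w (-((ε : ℂ) / 2 / ((1 - y ^ 2 : ℝ) : ℂ)) * w y) y := by
    intro y hy
    convert (hasDerivAt_div_rpow (ε / 4) hy).ofReal_comp using 1
    simp only [hw]
    push_cast
    ring
  have hφd : ∀ y ∈ Set.Ioo (-1 : ℝ) 1, HasDerivAt φ (deriv φ y) y := fun y hy =>
    ((hφ.differentiableOn (by norm_num)).differentiableAt (isOpen_Ioo.mem_nhds hy)).hasDerivAt
  have hφdd : HasDerivAt (deriv φ) (deriv (deriv φ) x) x :=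
    (((hφ.deriv_of_isOpen isOpen_Ioo (m := 1) (by norm_num)).differentiableOn
      (by norm_num)).differentiableAt (isOpen_Ioo.mem_nhds hx)).hasDerivAt
  have hΦd : ∀ y ∈ Set.Ioo (-1 : ℝ) 1, deriv (fun z => w z * φ z) y =
      -((ε : ℂ) / 2 / ((1 - y ^ 2 : ℝ) : ℂ)) * w y * φ y + w y * deriv φ y := fun y hy =>
    ((hwd y hy).mul (hφd y hy)).deriv
  have hpφ : HasDerivAt (fun y => ((1 - y ^ 2 : ℝ) : ℂ) * deriv φ y)
      (deriv (fun y => ((1 - y ^ 2 : ℝ) : ℂ) * deriv φ y) x) x := by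
    have hp : DifferentiableAt ℝ (fun y : ℝ => ((1 - y ^ 2 : ℝ) : ℂ)) x :=
      (((hasDerivAt_pow 2 x).const_sub 1).ofReal_comp).differentiableAt
    exact (hp.mul hφdd.differentiableAt).hasDerivAt
  have hflux : (fun y => ((1 - y ^ 2 : ℝ) : ℂ) * deriv (fun z => w z * φ z) y) =ᶠ[nhds x]
      fun y => w y * (((1 - y ^ 2 : ℝ) : ℂ) * deriv φ y - (ε : ℂ) / 2 * φ y) := by
    filter_upwards [isOpen_Ioo.mem_nhds hx] with y hy
    rw [hΦd y hy]
    have := hpos y hy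
    field_simp
    ring
  have hfluxd : deriv (fun y => w y * (((1 - y ^ 2 : ℝ) : ℂ) * deriv φ y - (ε : ℂ) / 2 * φ y)) x =
      -((ε : ℂ) / 2 / ((1 - x ^ 2 : ℝ) : ℂ)) * w x *
          (((1 - x ^ 2 : ℝ) : ℂ) * deriv φ x - (ε : ℂ) / 2 * φ x) +
        w x * (deriv (fun y => ((1 - y ^ 2 : ℝ) : ℂ) * deriv φ y) x - (ε : ℂ) / 2 * deriv φ x) :=
    ((hwd x hx).mul (hpφ.sub ((hφd x hx).const_mul ((ε : ℂ) / 2)))).deriv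
  have hE := heq x hx
  have hx0 := hpos x hx
  change SturmLiouvilleK k (fun y => w y * φ y) x
    + (ε : ℂ) * deriv (fun y => w y * φ y) x = μ * (w x * φ x)
  rw [SturmLiouvilleK, hflux.deriv_eq, hΦd x hx, hfluxd]
  rw [hσ2, Complex.ofReal_div] at hE
  generalize deriv (fun y => ((1 - y ^ 2 : ℝ) : ℂ) * deriv φ y) x = D at hE ⊢
  generalize ((1 - x ^ 2 : ℝ) : ℂ) = p at hE hx0 ⊢
  push_cast at hE
  rw [show μ * (w x * φ x) = w x * (μ * φ x) by ring, ← hE]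
  field_simp
  ring
end

section
/- For every σ ≥ 0 and every natural number n, there exists a polynomial F of degree at most n with F(1) = 1 such that the function φ(x) := (1 − x²)^{σ/2} · F(x) satisfies the associated Legendre equation ((1 − x²) φ'(x))' − (σ²/(1 − x²)) φ(x) = −(σ + n)(σ + n + 1) φ(x) for all x ∈ (−1,1). In particular, μ_n = −s_n(s_n + 1) with s_n = σ + n is an eigenvalue of the associated Legendre equation with a regular eigenfunction for every n ≥ 0. -/
open Real

/-- The Taylor coefficients at `1` of the polynomial solution of the Gegenbauer equation. -/
noncomputable def gegenbauerTaylorCoeff (σ : ℝ) (n : ℕ) : ℕ → ℝ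
  | 0 => 1
  | k + 1 => (n * (n + 2 * σ + 1) - k * (k + 2 * σ + 1)) / (2 * (k + 1) * (k + σ + 1))
      * gegenbauerTaylorCoeff σ n k

theorem gegenbauerTaylorCoeff_succ {σ : ℝ} (hσ : 0 ≤ σ) (n k : ℕ) :
    2 * (k + 1) * (k + σ + 1) * gegenbauerTaylorCoeff σ n (k + 1)
      = (n * (n + 2 * σ + 1) - k * (k + 2 * σ + 1)) * gegenbauerTaylorCoeff σ n k := by
  have : (2 * ((k : ℝ) + 1) * (k + σ + 1)) ≠ 0 := by positivity
  rw [gegenbauerTaylorCoeff, ← mul_assoc, mul_div_cancel₀ _ this]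

theorem gegenbauerTaylorCoeff_eq_zero (σ : ℝ) {n k : ℕ} (h : n < k) :
    gegenbauerTaylorCoeff σ n k = 0 := by
  induction k, h using Nat.le_induction with
  | base => simp [gegenbauerTaylorCoeff]
  | succ k _ ih => simp [gegenbauerTaylorCoeff, ih]

open Polynomial in
/-- The Gegenbauer equation, written in the variable `X = x - 1`, has a polynomial solution of
degree at most `n` that equals `1` at `X = 0`. -/
theorem exists_shifted_gegenbauer_polynomial {σ : ℝ} (hσ : 0 ≤ σ) (n : ℕ) :
    ∃ P : ℝ[X], P.degree ≤ n ∧ P.coeff 0 = 1 ∧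
      X * (X * derivative (derivative P)) + C 2 * (X * derivative (derivative P))
        + C (2 * (σ + 1)) * (X * derivative P) + C (2 * (σ + 1)) * derivative P
        = C (n * (n + 2 * σ + 1)) * P := by
  set P : ℝ[X] := ∑ k ∈ Finset.range (n + 1), monomial k (gegenbauerTaylorCoeff σ n k) with hP
  have hcoeff (k : ℕ) : P.coeff k = gegenbauerTaylorCoeff σ n k := by
    simp only [hP, finsetSum_coeff, coeff_monomial, Finset.sum_ite_eq', Finset.mem_range]
    split_ifs with h
    · rfl
    · exact (gegenbauerTaylorCoeff_eq_zero σ (by omega)).symm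
  refine ⟨P, (degree_le_iff_coeff_zero _ _).2 fun k hk => ?_, ?_, ?_⟩
  · rw [hcoeff, gegenbauerTaylorCoeff_eq_zero σ (by exact_mod_cast hk)]
  · rw [hcoeff, gegenbauerTaylorCoeff]
  · ext k
    have h := gegenbauerTaylorCoeff_succ hσ n k
    rcases k with _ | _ | k <;>
    · simp only [coeff_add, coeff_C_mul, coeff_X_mul, mul_coeff_zero, coeff_X_zero, coeff_C_zero,
        coeff_derivative, hcoeff]
      push_cast at h ⊢
      linear_combination h

open Polynomial in
theorem exists_gegenbauer_polynomial {σ : ℝ} (hσ : 0 ≤ σ) (n : ℕ) :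
    ∃ F : ℝ[X], F.degree ≤ n ∧ F.eval 1 = 1 ∧ ∀ x : ℝ,
      (1 - x ^ 2) * (derivative (derivative F)).eval x
        - 2 * (σ + 1) * x * (derivative F).eval x + n * (n + 2 * σ + 1) * F.eval x = 0 := by
  obtain ⟨P, hdeg, h0, hode⟩ := exists_shifted_gegenbauer_polynomial hσ n
  refine ⟨P.comp (X - C 1), ?_, ?_, fun x => ?_⟩
  · refine degree_le_of_natDegree_le ?_
    rw [natDegree_comp, natDegree_X_sub_C, mul_one]
    exact natDegree_le_of_degree_le hdeg
  · rw [eval_comp, ← h0, coeff_zero_eq_eval_zero]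
    simp
  · have h := congrArg (eval (x - 1)) hode
    simp only [eval_add, eval_mul, eval_X, eval_C] at h
    simp only [derivative_comp, derivative_sub, derivative_X, derivative_C, sub_zero, one_mul,
      eval_comp, eval_sub, eval_X, eval_C]
    linear_combination -h

theorem hasDerivAt_one_sub_sq_rpow_mul (σ : ℝ) (G : Polynomial ℝ) {x : ℝ} (hx : 0 < 1 - x ^ 2) :
    HasDerivAt (fun y : ℝ => (1 - y ^ 2) ^ (σ / 2) * G.eval y)
      ((1 - x ^ 2) ^ (σ / 2) * (G.derivative.eval x - σ * x / (1 - x ^ 2) * G.eval x)) x := by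
  have h1 : HasDerivAt (fun y : ℝ => 1 - y ^ 2) (-(2 * x)) x := by
    simpa using (hasDerivAt_pow 2 x).const_sub 1
  refine ((h1.rpow_const (p := σ / 2) (Or.inl hx.ne')).mul (G.hasDerivAt x)).congr_deriv ?_
  rw [rpow_sub_one hx.ne']
  ring

/-- For every `σ ≥ 0` and `n ∈ ℕ` there is a polynomial `F` of degree at most `n`
with `F(1) = 1` such that `φ(x) = (1 − x²)^{σ/2} F(x)` is a regular eigenfunction
of the associated Legendre equation with eigenvalue `μ_n = −(σ+n)(σ+n+1)`. -/
theorem Legendre_eigenvalues_exist (σ : ℝ) (hσ : 0 ≤ σ) (n : ℕ) :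
    ∃ F : Polynomial ℝ, F.degree ≤ n ∧ F.eval 1 = 1 ∧
      ∀ x ∈ Set.Ioo (-1 : ℝ) 1,
        deriv (fun y => (1 - y ^ 2)
            * deriv (fun y' => (1 - y' ^ 2) ^ (σ / 2) * F.eval y') y) x
          - (σ ^ 2 / (1 - x ^ 2)) * ((1 - x ^ 2) ^ (σ / 2) * F.eval x)
          = -((σ + n) * (σ + n + 1)) * ((1 - x ^ 2) ^ (σ / 2) * F.eval x) := by
  obtain ⟨F, hdeg, h1, hode⟩ := exists_gegenbauer_polynomial hσ n
  refine ⟨F, hdeg, h1, fun x hx => ?_⟩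
  have hpos {y : ℝ} (hy : y ∈ Set.Ioo (-1 : ℝ) 1) : 0 < 1 - y ^ 2 := by
    nlinarith [hy.1, hy.2]
  let G : Polynomial ℝ := (1 - .X ^ 2) * F.derivative - .C σ * .X * F
  have hfirst : (fun y => (1 - y ^ 2) * deriv (fun y' => (1 - y' ^ 2) ^ (σ / 2) * F.eval y') y)
      =ᶠ[nhds x] fun y => (1 - y ^ 2) ^ (σ / 2) * G.eval y := by
    filter_upwards [isOpen_Ioo.mem_nhds hx] with y hy
    have hne := (hpos hy).ne'
    rw [(hasDerivAt_one_sub_sq_rpow_mul σ F (hpos hy)).deriv]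
    simp only [G, Polynomial.eval_sub, Polynomial.eval_mul, Polynomial.eval_pow,
      Polynomial.eval_one, Polynomial.eval_X, Polynomial.eval_C]
    field_simp
  have hne := (hpos hx).ne'
  rw [hfirst.deriv_eq, (hasDerivAt_one_sub_sq_rpow_mul σ G (hpos hx)).deriv]
  have hG : G.derivative.eval x - σ * x / (1 - x ^ 2) * G.eval x - σ ^ 2 / (1 - x ^ 2) * F.eval x
      = -((σ + n) * (σ + n + 1)) * F.eval x := by
    simp only [G, Polynomial.derivative_sub, Polynomial.derivative_mul, Polynomial.derivative_one,
      Polynomial.derivative_X_pow, Polynomial.derivative_X, Polynomial.derivative_C,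
      Polynomial.eval_sub, Polynomial.eval_add, Polynomial.eval_mul, Polynomial.eval_pow,
      Polynomial.eval_one, Polynomial.eval_X, Polynomial.eval_C, Polynomial.eval_zero]
    field_simp
    push_cast
    linear_combination (1 - x ^ 2) * hode x
  linear_combination (1 - x ^ 2) ^ (σ / 2) * hG
end

section
/- Let ε ≥ 0, μ ∈ ℝ, and let I ⊆ (−1,1) be an open interval. Suppose χ : I → ℝ is twice continuously differentiable and satisfies ((1 − x²)χ'(x))' − ((ε² + 4 + 4εx)/(4(1 − x²))) χ(x) = μ χ(x) for all x ∈ I. Define φ(x) := √(1 − x²) · χ'(x) − ((ε + 2x)/(2√(1 − x²))) · χ(x). Then for all x ∈ I: (i) μ χ(x) = √(1 − x²) · φ'(x) + (ε/(2√(1 − x²))) · φ(x), and (ii) φ satisfies the associated Legendre equation ((1 − x²)φ'(x))' − (ε²/(4(1 − x²))) φ(x) = μ φ(x). (These are the Darboux–Bäcklund transformations between the two self-adjoint forms of the symmetry-preserving linearized problem.) -/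
open Real

/-- The derivative of `√(1 − y²)` at a point of `(-1, 1)`. -/
lemma hasDerivAt_sqrt_one_sub_sq {x : ℝ} (hx : x ∈ Set.Ioo (-1 : ℝ) 1) :
    HasDerivAt (fun y : ℝ => √(1 - y ^ 2)) (-x / √(1 - x ^ 2)) x := by
  have hp : 0 < 1 - x ^ 2 := by nlinarith [hx.1, hx.2]
  have hs : √(1 - x ^ 2) ≠ 0 := (Real.sqrt_pos.2 hp).ne'
  convert ((hasDerivAt_pow 2 x).const_sub 1).sqrt hp.ne' using 1
  norm_num
  field_simp

/-- Darboux–Bäcklund transformations between the two self-adjoint forms of the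
symmetry-preserving linearized problem: if `χ` solves
`((1 − x²)χ')' − ((ε² + 4 + 4εx)/(4(1 − x²)))χ = μχ` on an open interval
`I ⊆ (−1,1)`, then `φ := √(1 − x²) χ' − ((ε + 2x)/(2√(1 − x²))) χ` satisfies
`μχ = √(1 − x²) φ' + (ε/(2√(1 − x²))) φ` and the associated Legendre equation
`((1 − x²)φ')' − (ε²/(4(1 − x²)))φ = μφ` on `I`. -/
theorem darboux_backlund (ε : ℝ) (hε : 0 ≤ ε) (μ : ℝ) (a b : ℝ)
    (hI : Set.Ioo a b ⊆ Set.Ioo (-1 : ℝ) 1)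
    (χ : ℝ → ℝ)
    (hχ : ContDiffOn ℝ 2 χ (Set.Ioo a b))
    (heq : ∀ x ∈ Set.Ioo a b,
      deriv (fun y => (1 - y ^ 2) * deriv χ y) x
        - ((ε ^ 2 + 4 + 4 * ε * x) / (4 * (1 - x ^ 2))) * χ x = μ * χ x) :
    let φ : ℝ → ℝ := fun x => Real.sqrt (1 - x ^ 2) * deriv χ x
      - ((ε + 2 * x) / (2 * Real.sqrt (1 - x ^ 2))) * χ x
    ∀ x ∈ Set.Ioo a b,
      (μ * χ x = Real.sqrt (1 - x ^ 2) * deriv φ x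
          + (ε / (2 * Real.sqrt (1 - x ^ 2))) * φ x)
      ∧ deriv (fun y => (1 - y ^ 2) * deriv φ y) x
          - (ε ^ 2 / (4 * (1 - x ^ 2))) * φ x = μ * φ x := by
  intro φ
  have hp : ∀ x ∈ Set.Ioo a b, 0 < 1 - x ^ 2 := fun x hx => by
    nlinarith [(hI hx).1, (hI hx).2]
  have hs : ∀ x ∈ Set.Ioo a b, 0 < √(1 - x ^ 2) := fun x hx => Real.sqrt_pos.2 (hp x hx)
  have hsq : ∀ x ∈ Set.Ioo a b, √(1 - x ^ 2) ^ 2 = 1 - x ^ 2 := fun x hx =>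
    Real.sq_sqrt (hp x hx).le
  have hχ' : ∀ x ∈ Set.Ioo a b, HasDerivAt χ (deriv χ x) x := fun x hx =>
    ((hχ.differentiableOn (by norm_num)).differentiableAt (isOpen_Ioo.mem_nhds hx)).hasDerivAt
  have hχ'' : ∀ x ∈ Set.Ioo a b, HasDerivAt (deriv χ) (deriv (deriv χ) x) x := fun x hx =>
    (((hχ.deriv_of_isOpen (m := 1) isOpen_Ioo (by norm_num)).differentiableOn
      (by norm_num)).differentiableAt (isOpen_Ioo.mem_nhds hx)).hasDerivAt
  have hode : ∀ x ∈ Set.Ioo a b, (1 - x ^ 2) * deriv (deriv χ) x - 2 * x * deriv χ x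
      - ((ε ^ 2 + 4 + 4 * ε * x) / (4 * (1 - x ^ 2))) * χ x = μ * χ x := fun x hx => by
    have h : HasDerivAt (fun y => (1 - y ^ 2) * deriv χ y) _ x :=
      (((hasDerivAt_id x).pow 2).const_sub 1).mul (hχ'' x hx)
    have hx' := heq x hx
    rw [h.deriv] at hx'
    simp only [id_eq, Pi.pow_apply] at hx'
    linear_combination hx'
  have hφ : ∀ x ∈ Set.Ioo a b, HasDerivAt φ
      ((-x / √(1 - x ^ 2)) * deriv χ x + √(1 - x ^ 2) * deriv (deriv χ) x
        - ((2 * (2 * √(1 - x ^ 2)) - (ε + 2 * x) * (2 * (-x / √(1 - x ^ 2))))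
            / (2 * √(1 - x ^ 2)) ^ 2 * χ x
          + (ε + 2 * x) / (2 * √(1 - x ^ 2)) * deriv χ x)) x := fun x hx => by
    have hr := hasDerivAt_sqrt_one_sub_sq (hI hx)
    have hn : HasDerivAt (fun y : ℝ => ε + 2 * y) 2 x := by
      simpa using ((hasDerivAt_id x).const_mul 2).const_add ε
    exact (hr.mul (hχ'' x hx)).sub
      ((hn.div (hr.const_mul 2) (mul_pos two_pos (hs x hx)).ne').mul (hχ' x hx))
  have hinv : ∀ x ∈ Set.Ioo a b, μ * χ x = √(1 - x ^ 2) * deriv φ x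
      + (ε / (2 * √(1 - x ^ 2))) * φ x := fun x hx => by
    have hs0 := (hs x hx).ne'
    have h2 := hsq x hx
    rw [(hφ x hx).deriv, ← hode x hx]
    simp only [φ]
    generalize √(1 - x ^ 2) = s at hs0 h2 ⊢
    rw [← h2]
    field_simp
    linear_combination (16 * χ x) * h2
  intro x hx
  refine ⟨hinv x hx, ?_⟩
  have hflux : (fun y => (1 - y ^ 2) * deriv φ y) =ᶠ[nhds x]
      fun y => √(1 - y ^ 2) * (μ * χ y) - ε / 2 * φ y := by
    filter_upwards [isOpen_Ioo.mem_nhds hx] with y hy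
    have hs0 := (hs y hy).ne'
    have h2 := hsq y hy
    rw [hinv y hy]
    generalize √(1 - y ^ 2) = s at hs0 h2 ⊢
    rw [← h2]
    field_simp
    ring
  have hd : HasDerivAt (fun y => √(1 - y ^ 2) * (μ * χ y) - ε / 2 * φ y) _ x :=
    ((hasDerivAt_sqrt_one_sub_sq (hI hx)).mul ((hχ' x hx).const_mul μ)).sub
      ((hφ x hx).differentiableAt.hasDerivAt.const_mul (ε / 2))
  rw [hflux.deriv_eq, hd.deriv]
  have hs0 := (hs x hx).ne'
  have hφ' : deriv φ x = (μ * χ x - ε / (2 * √(1 - x ^ 2)) * φ x) / √(1 - x ^ 2) := by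
    rw [hinv x hx]
    field_simp
    ring
  have h2 := hsq x hx
  rw [hφ']
  simp only [φ]
  generalize √(1 - x ^ 2) = s at hs0 h2 ⊢
  rw [← h2]
  field_simp
  ring
end

section
/- Let 0 < x₀ < 1, ε ≥ 0, and μ ∈ ℂ. Suppose χ : [−x₀, x₀] → ℂ is twice continuously differentiable, not identically zero, satisfies the Dirichlet boundary conditions χ(−x₀) = χ(x₀) = 0, and ((1 − x²)χ'(x))' − ((ε² + 4 + 4εx)/(4(1 − x²))) χ(x) = μ χ(x) for all x ∈ [−x₀, x₀]. Then μ is real and μ < 0. -/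
open Real

open Set
open scoped ComplexConjugate

/-- A function with nonnegative derivative and equal values at the endpoints has zero derivative. -/
theorem eq_zero_of_hasDerivAt_nonneg_of_endpoints_eq {a b : ℝ} {f f' : ℝ → ℝ}
    (hf : ContinuousOn f (Icc a b)) (hf' : ∀ x ∈ Ioo a b, HasDerivAt f (f' x) x)
    (hnonneg : ∀ x ∈ Ioo a b, 0 ≤ f' x) (hab : f a = f b) {x : ℝ} (hx : x ∈ Ioo a b) :
    f' x = 0 := by
  have hmono : MonotoneOn f (Icc a b) := by
    refine monotoneOn_of_deriv_nonneg (convex_Icc a b) hf ?_ ?_ <;> rw [interior_Icc]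
    · exact fun y hy => (hf' y hy).differentiableAt.differentiableWithinAt
    · exact fun y hy => (hf' y hy).deriv ▸ hnonneg y hy
  have hle : a ≤ b := (hx.1.trans hx.2).le
  have hconst : f =ᶠ[nhds x] fun _ => f a := by
    filter_upwards [Icc_mem_nhds hx.1 hx.2] with y hy
    exact le_antisymm (hab ▸ hmono hy (right_mem_Icc.2 hle) hy.2)
      (hmono (left_mem_Icc.2 hle) hy hy.1)
  exact (hf' x hx).unique ((hasDerivAt_const x (f a)).congr_of_eventuallyEq hconst)

theorem sq_add_four_add_mul_pos {ε x : ℝ} (hε : 0 ≤ ε) (hx : -1 < x) :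
    0 < ε ^ 2 + 4 + 4 * ε * x := by
  rcases hε.eq_or_lt with rfl | h
  · norm_num
  · nlinarith [mul_pos h (by linarith : 0 < 1 + x), sq_nonneg (ε - 2)]

/-- Derivative of the Wronskian-type product `p χ' conj χ` in the interior, when
`(p χ')' - q χ = μ χ`. -/
theorem hasDerivAt_mul_deriv_mul_conj {p : ℝ → ℝ} {χ : ℝ → ℂ} {q : ℝ} {μ : ℂ} {x : ℝ}
    (hp : DifferentiableAt ℝ p x) (hχ : DifferentiableAt ℝ χ x)
    (hχ' : DifferentiableAt ℝ (deriv χ) x)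
    (heq : deriv (fun y => (p y : ℂ) * deriv χ y) x - (q : ℂ) * χ x = μ * χ x) :
    HasDerivAt (fun y => (p y : ℂ) * deriv χ y * conj (χ y))
      ((q + μ) * (Complex.normSq (χ x) : ℂ) + (p x : ℂ) * (Complex.normSq (deriv χ x) : ℂ)) x := by
  have h1 : DifferentiableAt ℝ (fun y => (p y : ℂ) * deriv χ y) x :=
    hp.hasDerivAt.ofReal_comp.differentiableAt.mul hχ'
  have h2 : HasDerivAt (fun y => conj (χ y)) (conj (deriv χ x)) x := hχ.hasDerivAt.star
  refine (h1.hasDerivAt.mul h2).congr_deriv ?_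
  rw [sub_eq_iff_eq_add.1 heq, Complex.normSq_eq_conj_mul_self, Complex.normSq_eq_conj_mul_self]
  ring

/-- The Dirichlet eigenvalues of the Sturm–Liouville problem
`((1 − x²)χ')' − ((ε² + 4 + 4εx)/(4(1 − x²)))χ = μχ` on `[−x₀, x₀]`,
`0 < x₀ < 1`, `ε ≥ 0`, are real and strictly negative. -/
theorem dirichlet_eigenvalues_negative (x₀ : ℝ) (hx₀ : 0 < x₀) (hx₀' : x₀ < 1)
    (ε : ℝ) (hε : 0 ≤ ε) (μ : ℂ) (χ : ℝ → ℂ)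
    (hχ : ContDiffOn ℝ 2 χ (Set.Icc (-x₀) x₀))
    (hχne : ∃ x ∈ Set.Icc (-x₀) x₀, χ x ≠ 0)
    (hbc₁ : χ (-x₀) = 0) (hbc₂ : χ x₀ = 0)
    (heq : ∀ x ∈ Set.Icc (-x₀) x₀,
      deriv (fun y => ((1 - y ^ 2 : ℝ) : ℂ) * deriv χ y) x
        - (((ε ^ 2 + 4 + 4 * ε * x) / (4 * (1 - x ^ 2)) : ℝ) : ℂ) * χ x
        = μ * χ x) :
    μ.im = 0 ∧ μ.re < 0 := by
  set s := Icc (-x₀) x₀ with hs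
  set p : ℝ → ℝ := fun y => 1 - y ^ 2 with hp
  set q : ℝ → ℝ := fun x => (ε ^ 2 + 4 + 4 * ε * x) / (4 * (1 - x ^ 2)) with hq
  have hlt : -x₀ < x₀ := by linarith
  have hpd : Differentiable ℝ p := by fun_prop
  have hppos : ∀ x ∈ Ioo (-x₀) x₀, 0 < p x := fun x hx => by
    simp only [hp]; nlinarith [hx.1, hx.2]
  have hqpos : ∀ x ∈ Ioo (-x₀) x₀, 0 < q x := fun x hx =>
    div_pos (sq_add_four_add_mul_pos hε (by linarith [hx.1])) (mul_pos four_pos (hppos x hx))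
  have hg : ContDiffOn ℝ 1 (derivWithin χ s) s :=
    hχ.derivWithin (uniqueDiffOn_Icc hlt) (by norm_num)
  have hnhds : ∀ x ∈ Ioo (-x₀) x₀, s ∈ nhds x := fun x hx => Icc_mem_nhds hx.1 hx.2
  have hgeq : ∀ x ∈ Ioo (-x₀) x₀, derivWithin χ s =ᶠ[nhds x] deriv χ := fun x hx => by
    filter_upwards [Ioo_mem_nhds hx.1 hx.2] with y hy
    exact derivWithin_of_mem_nhds (hnhds y hy)
  set F : ℝ → ℂ := fun y => (p y : ℂ) * derivWithin χ s y * conj (χ y) with hF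
  have hFcont : ContinuousOn F s :=
    ((Complex.continuous_ofReal.comp hpd.continuous).continuousOn.mul hg.continuousOn).mul
      (Complex.continuous_conj.comp_continuousOn hχ.continuousOn)
  have hFa : F (-x₀) = 0 := by simp [hF, hbc₁]
  have hFb : F x₀ = 0 := by simp [hF, hbc₂]
  have hFderiv : ∀ x ∈ Ioo (-x₀) x₀, HasDerivAt F
      ((q x + μ) * (Complex.normSq (χ x) : ℂ) + (p x : ℂ) * (Complex.normSq (deriv χ x) : ℂ)) x := by
    intro x hx
    have hd : DifferentiableAt ℝ (deriv χ) x :=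
      ((hg.contDiffAt (hnhds x hx)).differentiableAt (by norm_num)).congr_of_eventuallyEq
        (hgeq x hx).symm
    refine (hasDerivAt_mul_deriv_mul_conj (hpd x)
      ((hχ.contDiffAt (hnhds x hx)).differentiableAt (by norm_num)) hd
      (heq x (Ioo_subset_Icc_self hx))).congr_of_eventuallyEq ?_
    filter_upwards [hgeq x hx] with y hy
    simp only [hF, hy]
  have hre : ∀ x ∈ Ioo (-x₀) x₀, HasDerivAt (fun y => (F y).re)
      ((q x + μ.re) * Complex.normSq (χ x) + p x * Complex.normSq (deriv χ x)) x := fun x hx =>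
    (Complex.reCLM.hasFDerivAt.comp_hasDerivAt x (hFderiv x hx)).congr_deriv (by simp)
  have him : ∀ x ∈ Ioo (-x₀) x₀, HasDerivAt (fun y => μ.im * (F y).im)
      (μ.im ^ 2 * Complex.normSq (χ x)) x := fun x hx =>
    ((Complex.imCLM.hasFDerivAt.comp_hasDerivAt x (hFderiv x hx)).const_mul μ.im).congr_deriv
      (by simp [sq, mul_assoc])
  obtain ⟨x, hxs, hχx⟩ := hχne
  have hx : x ∈ Ioo (-x₀) x₀ :=
    ⟨hxs.1.lt_of_ne (by rintro rfl; exact hχx hbc₁), hxs.2.lt_of_ne (by rintro rfl; exact hχx hbc₂)⟩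
  have hχpos : 0 < Complex.normSq (χ x) := Complex.normSq_pos.2 hχx
  constructor
  · have h := eq_zero_of_hasDerivAt_nonneg_of_endpoints_eq
      (continuousOn_const.mul (Complex.continuous_im.comp_continuousOn hFcont)) him
      (fun y _ => mul_nonneg (sq_nonneg _) (Complex.normSq_nonneg _)) (by simp [hFa, hFb]) hx
    simpa [hχx] using h
  · by_contra! hμ
    have h := eq_zero_of_hasDerivAt_nonneg_of_endpoints_eq
      (Complex.continuous_re.comp_continuousOn hFcont) hre
      (fun y hy => add_nonneg
        (mul_nonneg (add_nonneg (hqpos y hy).le hμ) (Complex.normSq_nonneg _))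
        (mul_nonneg (hppos y hy).le (Complex.normSq_nonneg _))) (by simp [hFa, hFb]) hx
    have h1 : 0 < (q x + μ.re) * Complex.normSq (χ x) :=
      mul_pos (add_pos_of_pos_of_nonneg (hqpos x hx) hμ) hχpos
    have h2 : 0 ≤ p x * Complex.normSq (deriv χ x) :=
      mul_nonneg (hppos x hx).le (Complex.normSq_nonneg _)
    linarith
end
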